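/- arXiv:2105.06985 — 6 statements merged into one kernel-verified Lean document; each statement's English description precedes it below -/
import Mathlib

section
/- For every λ ≥ 0, the log-moment generating function Λ of the discretized Gaussian satisfies Λ₀(λ) − λΔx/2 ≤ Λ(λ) ≤ Λ₀(λ) + λΔx/2. -/
open MeasureTheory Real Set

/-- The discretized Gaussian weight `μ(j)`. -/
noncomputable def gaussMu (Δt Δx : ℝ) (j : ℤ) : ℝ :=
  ∫ x in (((j : ℝ) - 1/2) * Δx)..(((j : ℝ) + 1/2) * Δx),
    (Real.sqrt (2 * Real.pi * Δt))⁻¹ * Real.exp (-x ^ 2 / (2 * Δt))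

/-- The log-moment generating function `Λ` of the discretized Gaussian. -/
noncomputable def LambdaFn (Δt Δx : ℝ) (l : ℝ) : ℝ :=
  Real.log (∑' j : ℤ, gaussMu Δt Δx j * Real.exp (l * (j * Δx)))

open MeasureTheory Real Set in
theorem aux_hasSum {f : ℝ → ℝ} (hf : Integrable f) (d : ℝ) (hd : 0 < d) :
    HasSum (fun j : ℤ => ∫ x in (((j : ℝ) - 1/2) * d)..(((j : ℝ) + 1/2) * d), f x) (∫ x, f x) := by
  have h1 : Integrable (fun x => f (d * x)) := hf.comp_mul_left' hd.ne'
  have h2 := (h1.hasSum_intervalIntegral (-(1/2))).mul_left d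
  rw [Measure.integral_comp_mul_left, abs_of_pos (inv_pos.2 hd), smul_eq_mul,
    mul_inv_cancel_left₀ hd.ne'] at h2
  refine Eq.mp (congrArg (fun g => HasSum g _) (funext fun j => ?_)) h2
  rw [intervalIntegral.integral_comp_mul_left _ hd.ne', smul_eq_mul, mul_inv_cancel_left₀ hd.ne']
  congr 1 <;> ring

open MeasureTheory Real Set ProbabilityTheory in
theorem aux_gauss (t : ℝ) (ht : 0 < t) (l : ℝ) :
    Integrable (fun x : ℝ => (Real.sqrt (2 * Real.pi * t))⁻¹ * Real.exp (-x ^ 2 / (2 * t)) * Real.exp (l * x)) ∧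
    ∫ x : ℝ, (Real.sqrt (2 * Real.pi * t))⁻¹ * Real.exp (-x ^ 2 / (2 * t)) * Real.exp (l * x)
      = Real.exp (t / 2 * l ^ 2) := by
  obtain ⟨v, rfl⟩ : ∃ v : NNReal, (v : ℝ) = t := ⟨t.toNNReal, Real.coe_toNNReal t ht.le⟩
  have e : (fun x : ℝ => (Real.sqrt (2 * Real.pi * (v : ℝ)))⁻¹ * Real.exp (-x ^ 2 / (2 * (v : ℝ))) * Real.exp (l * x))
      = fun x => Real.exp ((v : ℝ) / 2 * l ^ 2) * gaussianPDFReal ((v : ℝ) * l) v x := by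
    funext x
    simp only [gaussianPDFReal]
    rw [mul_assoc, ← Real.exp_add, mul_left_comm, ← Real.exp_add]
    congr 2
    field_simp
    ring
  have hv : v ≠ 0 := fun h => ht.ne' (by simp [h])
  rw [e]
  refine ⟨(integrable_gaussianPDFReal _ _).const_mul _, ?_⟩
  rw [integral_const_mul, integral_gaussianPDFReal_eq_one _ hv, mul_one]

/-- For every `λ ≥ 0`, `Λ₀(λ) − λΔx/2 ≤ Λ(λ) ≤ Λ₀(λ) + λΔx/2`,
where `Λ₀(λ) = (Δt/2)λ²`. -/
theorem stmt_0 (Δt Δx : ℝ) (hΔt : 0 < Δt) (hΔx : 0 < Δx) (l : ℝ) (hl : 0 ≤ l) :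
    Δt / 2 * l ^ 2 - l * Δx / 2 ≤ LambdaFn Δt Δx l ∧
      LambdaFn Δt Δx l ≤ Δt / 2 * l ^ 2 + l * Δx / 2 := by
  obtain ⟨hi, hI⟩ := aux_gauss Δt hΔt l
  have hs := aux_hasSum hi Δx hΔx
  rw [hI] at hs
  set I : ℤ → ℝ := fun j => ∫ x in (((j : ℝ) - 1/2) * Δx)..(((j : ℝ) + 1/2) * Δx),
    (Real.sqrt (2 * Real.pi * Δt))⁻¹ * Real.exp (-x ^ 2 / (2 * Δt)) * Real.exp (l * x) with hIdef
  have hab : ∀ j : ℤ, ((j : ℝ) - 1/2) * Δx ≤ ((j : ℝ) + 1/2) * Δx := fun j => by nlinarith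
  have hup : ∀ j : ℤ, gaussMu Δt Δx j * Real.exp (l * (j * Δx)) ≤ Real.exp (l * Δx / 2) * I j := by
    intro j
    rw [gaussMu, hIdef, ← intervalIntegral.integral_mul_const, ← intervalIntegral.integral_const_mul]
    refine intervalIntegral.integral_mono_on (hab j)
      (Continuous.intervalIntegrable (by fun_prop) _ _)
      (Continuous.intervalIntegrable (by fun_prop) _ _) ?_
    intro x hx
    rw [mul_left_comm (Real.exp _), ← Real.exp_add]
    gcongr
    nlinarith [mul_le_mul_of_nonneg_left hx.1 hl]
  have hlo : ∀ j : ℤ, Real.exp (-(l * Δx / 2)) * I j ≤ gaussMu Δt Δx j * Real.exp (l * (j * Δx)) := by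
    intro j
    rw [gaussMu, hIdef, ← intervalIntegral.integral_mul_const, ← intervalIntegral.integral_const_mul]
    refine intervalIntegral.integral_mono_on (hab j)
      (Continuous.intervalIntegrable (by fun_prop) _ _)
      (Continuous.intervalIntegrable (by fun_prop) _ _) ?_
    intro x hx
    rw [mul_left_comm (Real.exp _), ← Real.exp_add]
    gcongr
    nlinarith [mul_le_mul_of_nonneg_left hx.2 hl]
  have hnn : ∀ j : ℤ, 0 ≤ gaussMu Δt Δx j * Real.exp (l * (j * Δx)) := by
    intro j
    refine mul_nonneg (intervalIntegral.integral_nonneg (hab j) fun x _ => by positivity)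
      (Real.exp_pos _).le
  have hU := hs.mul_left (Real.exp (l * Δx / 2))
  have hL := hs.mul_left (Real.exp (-(l * Δx / 2)))
  have hS := (Summable.of_nonneg_of_le hnn hup hU.summable).hasSum
  have h1 := hasSum_le hup hS hU
  have h2 := hasSum_le hlo hL hS
  rw [← Real.exp_add] at h1 h2
  have hpos := (Real.exp_pos _).trans_le h2
  rw [LambdaFn]
  constructor
  · rw [Real.le_log_iff_exp_le hpos]
    refine le_trans (le_of_eq ?_) h2
    congr 1; ring
  · rw [Real.log_le_iff_le_exp hpos]
    refine h1.trans (le_of_eq ?_)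
    congr 1; ring
end

section
/- For every m > 1 the equation I(c) = log m has a unique solution c ∈ (0, ∞). -/
open MeasureTheory Real Set

/-- The convex conjugate (rate function) `I(y) = sup_λ (λy − Λ(λ))`. -/
noncomputable def rateI (Δt Δx : ℝ) (y : ℝ) : ℝ :=
  ⨆ l : ℝ, l * y - LambdaFn Δt Δx l

lemma gm_pos (Δt Δx : ℝ) (hΔt : 0 < Δt) (hΔx : 0 < Δx) (j : ℤ) : 0 < gaussMu Δt Δx j := by
  unfold gaussMu
  apply intervalIntegral.intervalIntegral_pos_of_pos
  · apply Continuous.intervalIntegrable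
    fun_prop
  · intro x
    have := Real.pi_pos
    positivity
  · nlinarith

lemma gm_symm (Δt Δx : ℝ) (j : ℤ) : gaussMu Δt Δx (-j) = gaussMu Δt Δx j := by
  unfold gaussMu
  have := intervalIntegral.integral_comp_neg (a := ((j : ℝ) - 1/2) * Δx) (b := ((j : ℝ) + 1/2) * Δx)
    (fun x => (Real.sqrt (2 * Real.pi * Δt))⁻¹ * Real.exp (-x ^ 2 / (2 * Δt)))
  simp only [neg_sq] at this
  rw [this]
  congr 1 <;> push_cast <;> ring

lemma gm_hasSum (Δx : ℝ) (hΔx : 0 < Δx) (f : ℝ → ℝ) (hf : Integrable f) :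
    HasSum (fun j : ℤ => ∫ x in (((j : ℝ) - 1/2) * Δx)..(((j : ℝ) + 1/2) * Δx), f x)
      (∫ x, f x) := by
  have h := hasSum_integral_iUnion (μ := volume) (f := f)
    (s := fun n : ℤ => Ioc (-(Δx/2) + n • Δx) (-(Δx/2) + (n + 1) • Δx))
    (fun i => measurableSet_Ioc) (pairwise_disjoint_Ioc_add_zsmul (-(Δx/2)) Δx) hf.integrableOn
  rw [iUnion_Ioc_add_zsmul hΔx, setIntegral_univ] at h
  have e : (fun j : ℤ => ∫ x in (((j : ℝ) - 1/2) * Δx)..(((j : ℝ) + 1/2) * Δx), f x) =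
      fun n : ℤ => ∫ x in Ioc (-(Δx/2) + n • Δx) (-(Δx/2) + (n + 1) • Δx), f x := by
    funext j
    rw [intervalIntegral.integral_of_le (by nlinarith)]
    congr 3 <;> simp <;> ring
  rw [e]
  exact h

lemma gm_int (Δt : ℝ) (hΔt : 0 < Δt) (l : ℝ) : Integrable (fun x : ℝ =>
    ((Real.sqrt (2 * Real.pi * Δt))⁻¹ * Real.exp (-x ^ 2 / (2 * Δt))) * Real.exp (l * x)) := by
  have h := ((integrable_exp_neg_mul_sq (b := 1 / (2 * Δt)) (by positivity)).comp_sub_right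
    (l * Δt)).const_mul ((Real.sqrt (2 * Real.pi * Δt))⁻¹ * Real.exp (l ^ 2 * Δt / 2))
  convert h using 2 with x
  rw [mul_assoc _ (Real.exp _) (Real.exp _), mul_assoc _ (Real.exp _) (Real.exp _),
    ← Real.exp_add, ← Real.exp_add]
  congr 2
  field_simp
  ring

lemma gm_sum_one (Δt Δx : ℝ) (hΔt : 0 < Δt) (hΔx : 0 < Δx) : HasSum (gaussMu Δt Δx) 1 := by
  have h := gm_hasSum Δx hΔx _ (by simpa using gm_int Δt hΔt 0)
  suffices hs : ∫ x : ℝ, (Real.sqrt (2 * Real.pi * Δt))⁻¹ * Real.exp (-x ^ 2 / (2 * Δt)) = 1 by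
    rw [hs] at h
    exact h
  rw [integral_const_mul]
  have := integral_gaussian (1 / (2 * Δt))
  have e : (fun x : ℝ => Real.exp (-x ^ 2 / (2 * Δt))) =
      fun x : ℝ => Real.exp (-(1 / (2 * Δt)) * x ^ 2) := by
    ext x; congr 1; ring
  rw [e, this, show π / (1 / (2 * Δt)) = 2 * π * Δt by field_simp]
  have := Real.pi_pos
  rw [inv_mul_cancel₀]
  positivity

lemma gm_summable (Δt Δx : ℝ) (hΔt : 0 < Δt) (hΔx : 0 < Δx) (l : ℝ) :
    Summable (fun j : ℤ => gaussMu Δt Δx j * Real.exp (l * (j * Δx))) := by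
  have h := ((gm_hasSum Δx hΔx _ (gm_int Δt hΔt l)).summable).mul_right (Real.exp (|l| * Δx / 2))
  refine Summable.of_nonneg_of_le
    (fun j => mul_nonneg (gm_pos Δt Δx hΔt hΔx j).le (Real.exp_pos _).le) (fun j => ?_) h
  unfold gaussMu
  rw [← intervalIntegral.integral_mul_const, ← intervalIntegral.integral_mul_const]
  apply intervalIntegral.integral_mono_on
  · nlinarith
  · apply Continuous.intervalIntegrable; fun_prop
  · apply Continuous.intervalIntegrable; fun_prop
  · intro x hx
    have hp := Real.pi_pos
    rw [mul_assoc _ (Real.exp (l * x)), ← Real.exp_add]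
    apply mul_le_mul_of_nonneg_left _ (by positivity)
    apply Real.exp_le_exp.2
    have h1 : |j * Δx - x| ≤ Δx / 2 := by
      rw [abs_le]; constructor <;> nlinarith [hx.1, hx.2]
    have h2 : l * (j * Δx - x) ≤ |l| * (Δx / 2) :=
      (le_abs_self _).trans (by rw [abs_mul]; gcongr)
    linarith

lemma gm_M_ge (Δt Δx : ℝ) (hΔt : 0 < Δt) (hΔx : 0 < Δx) (l : ℝ) (k : ℤ) :
    Real.log (gaussMu Δt Δx k) + l * (k * Δx) ≤ LambdaFn Δt Δx l := by
  have hk := gm_pos Δt Δx hΔt hΔx k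
  have h := (gm_summable Δt Δx hΔt hΔx l).le_tsum k
    (fun j _ => mul_nonneg (gm_pos Δt Δx hΔt hΔx j).le (Real.exp_pos _).le)
  unfold LambdaFn
  rw [← Real.log_exp (l * (k * Δx)), ← Real.log_mul hk.ne' (Real.exp_pos _).ne']
  exact Real.log_le_log (by positivity) h

lemma gm_L_nonneg (Δt Δx : ℝ) (hΔt : 0 < Δt) (hΔx : 0 < Δx) (l : ℝ) :
    0 ≤ LambdaFn Δt Δx l := by
  apply Real.log_nonneg
  have s1 := (gm_summable Δt Δx hΔt hΔx l).hasSum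
  have s2 := (Equiv.neg ℤ).hasSum_iff.2 s1
  have s3 := s1.add s2
  have s4 := (gm_sum_one Δt Δx hΔt hΔx).add (gm_sum_one Δt Δx hΔt hΔx)
  have := hasSum_le (fun j => ?_) s4 s3
  · linarith
  · simp only [Function.comp, Equiv.neg_apply, gm_symm]
    have hk := gm_pos Δt Δx hΔt hΔx j
    have a1 := Real.add_one_le_exp (l * (j * Δx))
    have a2 := Real.add_one_le_exp (l * (((-j : ℤ) : ℝ) * Δx))
    push_cast at a2 ⊢
    nlinarith

lemma gm_L_zero (Δt Δx : ℝ) (hΔt : 0 < Δt) (hΔx : 0 < Δx) : LambdaFn Δt Δx 0 = 0 := by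
  simp [LambdaFn, (gm_sum_one Δt Δx hΔt hΔx).tsum_eq]

lemma gm_bdd (Δt Δx : ℝ) (hΔt : 0 < Δt) (hΔx : 0 < Δx) (y : ℝ) :
    BddAbove (range fun l : ℝ => l * y - LambdaFn Δt Δx l) := by
  set a : ℤ := ⌈y / Δx⌉
  set b : ℤ := ⌊y / Δx⌋
  have ha : y ≤ a * Δx := by
    have := Int.le_ceil (y / Δx)
    rwa [div_le_iff₀ hΔx] at this
  have hb : b * Δx ≤ y := by
    have := Int.floor_le (y / Δx)
    rwa [le_div_iff₀ hΔx] at this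
  refine ⟨max (-Real.log (gaussMu Δt Δx a)) (-Real.log (gaussMu Δt Δx b)), ?_⟩
  rintro _ ⟨l, rfl⟩
  dsimp only
  have h1 := gm_M_ge Δt Δx hΔt hΔx l a
  have h2 := gm_M_ge Δt Δx hΔt hΔx l b
  rcases le_total 0 l with hl | hl
  · apply le_max_of_le_left
    nlinarith
  · apply le_max_of_le_right
    nlinarith

lemma gm_convex (Δt Δx : ℝ) (hΔt : 0 < Δt) (hΔx : 0 < Δx) :
    ConvexOn ℝ univ (rateI Δt Δx) := by
  refine ⟨convex_univ, fun x _ y _ a b ha hb hab => ?_⟩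
  apply ciSup_le
  intro l
  have h1 : l * x - LambdaFn Δt Δx l ≤ rateI Δt Δx x := le_ciSup (gm_bdd Δt Δx hΔt hΔx x) l
  have h2 : l * y - LambdaFn Δt Δx l ≤ rateI Δt Δx y := le_ciSup (gm_bdd Δt Δx hΔt hΔx y) l
  simp only [smul_eq_mul]
  have h3 := mul_le_mul_of_nonneg_left h1 ha
  have h4 := mul_le_mul_of_nonneg_left h2 hb
  have h5 : LambdaFn Δt Δx l = a * LambdaFn Δt Δx l + b * LambdaFn Δt Δx l := by
    rw [← add_mul, hab, one_mul]
  linarith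

lemma gm_I_zero (Δt Δx : ℝ) (hΔt : 0 < Δt) (hΔx : 0 < Δx) : rateI Δt Δx 0 = 0 := by
  apply le_antisymm
  · apply ciSup_le
    intro l
    have := gm_L_nonneg Δt Δx hΔt hΔx l
    linarith
  · have h : 0 * 0 - LambdaFn Δt Δx 0 ≤ rateI Δt Δx 0 := le_ciSup (gm_bdd Δt Δx hΔt hΔx 0) 0
    rw [gm_L_zero Δt Δx hΔt hΔx] at h
    linarith

lemma gm_uniq (Δt Δx : ℝ) (hΔt : 0 < Δt) (hΔx : 0 < Δx) (r : ℝ) (hr : 0 < r) (a b : ℝ)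
    (ha : 0 < a) (hab : a < b) (h1 : rateI Δt Δx a = r) (h2 : rateI Δt Δx b = r) : False := by
  have hb : 0 < b := ha.trans hab
  have hlt : a / b < 1 := (div_lt_one hb).2 hab
  have h := (gm_convex Δt Δx hΔt hΔx).2 (mem_univ 0) (mem_univ b)
    (sub_nonneg.2 hlt.le) (div_pos ha hb).le (by ring)
  simp only [smul_eq_mul, mul_zero, zero_add, gm_I_zero Δt Δx hΔt hΔx] at h
  rw [div_mul_cancel₀ _ hb.ne', h1, h2] at h
  nlinarith

/-- For every `m > 1` the equation `I(c) = log m` has a unique solution `c ∈ (0, ∞)`. -/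
theorem stmt_3 (Δt Δx : ℝ) (hΔt : 0 < Δt) (hΔx : 0 < Δx) (m : ℝ) (hm : 1 < m) :
    ∃! c : ℝ, 0 < c ∧ rateI Δt Δx c = Real.log m := by
  have hr := Real.log_pos hm
  have hL := gm_L_nonneg Δt Δx hΔt hΔx 1
  have hz := gm_I_zero Δt Δx hΔt hΔx
  have hc : ContinuousOn (rateI Δt Δx) univ :=
    (gm_convex Δt Δx hΔt hΔx).continuousOn isOpen_univ
  set B := Real.log m + LambdaFn Δt Δx 1
  have hB : 1 * B - LambdaFn Δt Δx 1 ≤ rateI Δt Δx B := le_ciSup (gm_bdd Δt Δx hΔt hΔx B) 1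
  obtain ⟨c, hc1, hc2⟩ := intermediate_value_Icc (a := 0) (b := B) (by simp only [B]; linarith)
    (hc.mono (subset_univ _))
    (show Real.log m ∈ Icc (rateI Δt Δx 0) (rateI Δt Δx B) from
      ⟨by rw [hz]; exact hr.le, by simp only [B] at hB ⊢; linarith⟩)
  have hc0 : 0 < c := by
    rcases hc1.1.eq_or_lt with h | h
    · rw [← h, hz] at hc2; linarith
    · exact h
  refine ⟨c, ⟨hc0, hc2⟩, ?_⟩
  rintro d ⟨hd0, hd⟩
  rcases lt_trichotomy d c with h | h | h
  · exact (gm_uniq Δt Δx hΔt hΔx _ hr d c hd0 h hd hc2).elim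
  · exact h
  · exact (gm_uniq Δt Δx hΔt hΔx _ hr c d hc0 h hc2 hd).elim
end

section
/- Let ρ > 1 and assume Δx < √(2Δt·log ρ). Set c₀ = √(2Δt·log ρ), so that I₀(c₀) = log ρ. If c > 0 satisfies I(c) = log ρ, then c₀/2 < c < 2c₀. -/
open MeasureTheory Real Set

lemma tilt_eq (Δt : ℝ) (hΔt : 0 < Δt) (l x : ℝ) :
    (Real.sqrt (2 * Real.pi * Δt))⁻¹ * Real.exp (-x ^ 2 / (2 * Δt)) * Real.exp (l * x) =
      Real.exp (l ^ 2 * Δt / 2) *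
        ProbabilityTheory.gaussianPDFReal (l * Δt) (Real.toNNReal Δt) x := by
  unfold ProbabilityTheory.gaussianPDFReal
  rw [Real.coe_toNNReal _ hΔt.le, mul_assoc, ← Real.exp_add, mul_left_comm, ← Real.exp_add]
  congr 2
  field_simp
  ring

lemma tilt_hasSum (Δt Δx : ℝ) (hΔt : 0 < Δt) (hΔx : 0 < Δx) (l : ℝ) :
    HasSum (fun j : ℤ => ∫ x in (((j : ℝ) - 1/2) * Δx)..(((j : ℝ) + 1/2) * Δx),
      (Real.sqrt (2 * Real.pi * Δt))⁻¹ * Real.exp (-x ^ 2 / (2 * Δt)) * Real.exp (l * x))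
      (Real.exp (l ^ 2 * Δt / 2)) := by
  simp_rw [tilt_eq Δt hΔt l]
  have hv : Real.toNNReal Δt ≠ 0 := by simpa using hΔt
  have hint : Integrable (fun x => Real.exp (l ^ 2 * Δt / 2) *
      ProbabilityTheory.gaussianPDFReal (l * Δt) (Real.toNNReal Δt) x) :=
    (ProbabilityTheory.integrable_gaussianPDFReal _ _).const_mul _
  have h := hasSum_integral_iUnion (μ := volume)
    (s := fun n : ℤ => Ioc (-Δx / 2 + n • Δx) (-Δx / 2 + (n + 1) • Δx))
    (fun _ => measurableSet_Ioc)
    (pairwise_disjoint_Ioc_add_zsmul (-Δx / 2) Δx) hint.integrableOn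
  rw [iUnion_Ioc_add_zsmul hΔx, setIntegral_univ, integral_const_mul,
    ProbabilityTheory.integral_gaussianPDFReal_eq_one _ hv, mul_one] at h
  refine (congrArg (fun f => HasSum f (Real.exp (l ^ 2 * Δt / 2))) (funext fun j => ?_)).mpr h
  rw [intervalIntegral.integral_of_le (by nlinarith)]
  have h1 : ((j : ℝ) - 1/2) * Δx = -Δx / 2 + j • Δx := by simp; ring
  have h2 : ((j : ℝ) + 1/2) * Δx = -Δx / 2 + (j + 1) • Δx := by simp; ring
  rw [h1, h2]

lemma exp_cell (Δx l x : ℝ) (j : ℤ) (hΔx : 0 < Δx)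
    (hx : x ∈ Icc (((j : ℝ) - 1/2) * Δx) (((j : ℝ) + 1/2) * Δx)) :
    |l * (j * Δx) - l * x| ≤ |l| * Δx / 2 := by
  rw [← mul_sub, abs_mul, mul_div_assoc]
  apply mul_le_mul_of_nonneg_left _ (abs_nonneg _)
  rw [abs_le]
  constructor <;> nlinarith [hx.1, hx.2]

lemma cell_bounds (Δt Δx : ℝ) (hΔx : 0 < Δx) (l : ℝ) (j : ℤ) :
    Real.exp (-(|l| * Δx / 2)) * (∫ x in (((j : ℝ) - 1/2) * Δx)..(((j : ℝ) + 1/2) * Δx),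
      (Real.sqrt (2 * Real.pi * Δt))⁻¹ * Real.exp (-x ^ 2 / (2 * Δt)) * Real.exp (l * x))
      ≤ gaussMu Δt Δx j * Real.exp (l * (j * Δx)) ∧
    gaussMu Δt Δx j * Real.exp (l * (j * Δx)) ≤
    Real.exp (|l| * Δx / 2) * (∫ x in (((j : ℝ) - 1/2) * Δx)..(((j : ℝ) + 1/2) * Δx),
      (Real.sqrt (2 * Real.pi * Δt))⁻¹ * Real.exp (-x ^ 2 / (2 * Δt)) * Real.exp (l * x)) := by
  unfold gaussMu
  rw [← intervalIntegral.integral_const_mul, ← intervalIntegral.integral_const_mul,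
    ← intervalIntegral.integral_mul_const]
  have hle : ((j : ℝ) - 1/2) * Δx ≤ ((j : ℝ) + 1/2) * Δx := by nlinarith
  constructor <;>
  · apply intervalIntegral.integral_mono_on hle
    · apply Continuous.intervalIntegrable; fun_prop
    · apply Continuous.intervalIntegrable; fun_prop
    intro x hx
    have h := abs_le.1 (exp_cell Δx l x j hΔx hx)
    rw [mul_left_comm (Real.exp _), ← Real.exp_add]
    apply mul_le_mul_of_nonneg_left _ (by positivity)
    apply Real.exp_le_exp.2
    linarith [h.1, h.2]

lemma Lambda_bounds (Δt Δx : ℝ) (hΔt : 0 < Δt) (hΔx : 0 < Δx) (l : ℝ) :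
    l ^ 2 * Δt / 2 - |l| * Δx / 2 ≤ LambdaFn Δt Δx l ∧
    LambdaFn Δt Δx l ≤ l ^ 2 * Δt / 2 + |l| * Δx / 2 := by
  have hs := tilt_hasSum Δt Δx hΔt hΔx l
  have hlo := hs.mul_left (Real.exp (-(|l| * Δx / 2)))
  have hhi := hs.mul_left (Real.exp (|l| * Δx / 2))
  have hb := cell_bounds Δt Δx hΔx l
  have hnn : ∀ j : ℤ, 0 ≤ gaussMu Δt Δx j * Real.exp (l * (j * Δx)) := by
    intro j
    refine le_trans ?_ (hb j).1
    apply mul_nonneg (Real.exp_pos _).le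
    apply intervalIntegral.integral_nonneg (by nlinarith)
    intro x _
    positivity
  have hsum : Summable (fun j : ℤ => gaussMu Δt Δx j * Real.exp (l * (j * Δx))) :=
    Summable.of_nonneg_of_le hnn (fun j => (hb j).2) hhi.summable
  have h1 := hasSum_le (fun j => (hb j).1) hlo hsum.hasSum
  have h2 := hasSum_le (fun j => (hb j).2) hsum.hasSum hhi
  rw [← Real.exp_add] at h1 h2
  have hpos := lt_of_lt_of_le (Real.exp_pos _) h1
  unfold LambdaFn
  constructor
  · rw [Real.le_log_iff_exp_le hpos]
    refine le_trans (le_of_eq ?_) h1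
    congr 1; ring
  · rw [Real.log_le_iff_le_exp hpos]
    refine le_trans h2 (le_of_eq ?_)
    congr 1; ring

lemma rate_le (Δt Δx : ℝ) (hΔt : 0 < Δt) (hΔx : 0 < Δx) (c : ℝ) (hc : 0 < c) (l : ℝ) :
    l * c - LambdaFn Δt Δx l ≤ (c + Δx / 2) ^ 2 / (2 * Δt) := by
  have h := (Lambda_bounds Δt Δx hΔt hΔx l).1
  have h1 : l * c ≤ |l| * c := mul_le_mul_of_nonneg_right (le_abs_self l) hc.le
  rw [← sq_abs l] at h
  have h2 : |l| * (c + Δx / 2) - |l| ^ 2 * Δt / 2 ≤ (c + Δx / 2) ^ 2 / (2 * Δt) := by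
    rw [le_div_iff₀ (by positivity)]
    nlinarith [sq_nonneg (|l| * Δt - (c + Δx / 2))]
  nlinarith

/-- Let `ρ > 1` and `Δx < √(2Δt log ρ) = c₀` (so `I₀(c₀) = log ρ`).
If `c > 0` satisfies `I(c) = log ρ`, then `c₀/2 < c < 2c₀`. -/
theorem stmt_4 (Δt Δx : ℝ) (hΔt : 0 < Δt) (hΔx : 0 < Δx) (ρ : ℝ) (hρ : 1 < ρ)
    (hxρ : Δx < Real.sqrt (2 * Δt * Real.log ρ)) (c : ℝ) (hc : 0 < c)
    (hceq : rateI Δt Δx c = Real.log ρ) :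
    Real.sqrt (2 * Δt * Real.log ρ) / 2 < c ∧ c < 2 * Real.sqrt (2 * Δt * Real.log ρ) := by
  set c₀ := Real.sqrt (2 * Δt * Real.log ρ) with hc₀
  have hlog : 0 < Real.log ρ := Real.log_pos hρ
  have hsq : c₀ ^ 2 = 2 * Δt * Real.log ρ := Real.sq_sqrt (by positivity)
  have hc₀pos : 0 < c₀ := hΔx.trans hxρ
  have hub := rate_le Δt Δx hΔt hΔx c hc
  constructor
  · have h : rateI Δt Δx c ≤ (c + Δx / 2) ^ 2 / (2 * Δt) := ciSup_le hub
    rw [hceq, le_div_iff₀ (by positivity)] at h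
    have h' : c₀ ≤ c + Δx / 2 := by
      apply le_of_sq_le_sq _ (by positivity)
      linarith
    linarith
  · by_contra hcon
    push Not at hcon
    have hbdd : BddAbove (Set.range fun l : ℝ => l * c - LambdaFn Δt Δx l) :=
      ⟨_, by rintro _ ⟨l, rfl⟩; exact hub l⟩
    have h := le_ciSup hbdd ((c - Δx / 2) / Δt)
    change _ ≤ rateI Δt Δx c at h
    have hL := (Lambda_bounds Δt Δx hΔt hΔx ((c - Δx / 2) / Δt)).2
    rw [abs_of_nonneg (div_nonneg (by linarith) hΔt.le)] at hL
    have h3 : (c - Δx / 2) ^ 2 / (2 * Δt) ≤ Real.log ρ := by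
      have e : (c - Δx / 2) ^ 2 / (2 * Δt) = (c - Δx / 2) / Δt * c -
          (((c - Δx / 2) / Δt) ^ 2 * Δt / 2 + (c - Δx / 2) / Δt * Δx / 2) := by
        field_simp
        ring
      rw [e]
      linarith
    rw [div_le_iff₀ (by positivity)] at h3
    nlinarith
end

section
/- Let y > 0 with Δx < y/2. Then for every η ≥ 0, I(y) + (y²/(4Δt))·η ≤ I((1+η)·y). -/
open MeasureTheory Real Set

/-- gaussian density -/
noncomputable def gd (v : ℝ) (x : ℝ) : ℝ := (Real.sqrt (2 * Real.pi * v))⁻¹ * Real.exp (-x ^ 2 / (2 * v))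

lemma gd_cont (v : ℝ) : Continuous (gd v) := by unfold gd; fun_prop

lemma gd_pos {v : ℝ} (hv : 0 < v) (x : ℝ) : 0 < gd v x := by unfold gd; positivity

lemma gd_tilt {v : ℝ} (hv : 0 < v) (l : ℝ) :
    (fun x => gd v x * Real.exp (l * x)) =
      fun x => Real.exp (l ^ 2 * v / 2) * ProbabilityTheory.gaussianPDFReal (l * v) v.toNNReal x := by
  funext x
  unfold gd ProbabilityTheory.gaussianPDFReal
  have : Real.exp (-x ^ 2 / (2 * v)) * Real.exp (l * x) =
      Real.exp (l ^ 2 * v / 2) * Real.exp (-(x - l * v) ^ 2 / (2 * v)) := by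
    rw [← Real.exp_add, ← Real.exp_add]
    congr 1
    field_simp
    ring
  rw [Real.coe_toNNReal v hv.le]
  rw [mul_assoc, this]
  ring

lemma gd_tilt_int {v : ℝ} (hv : 0 < v) (l : ℝ) :
    Integrable (fun x => gd v x * Real.exp (l * x)) := by
  rw [gd_tilt hv]
  exact (ProbabilityTheory.integrable_gaussianPDFReal _ _).const_mul _

lemma gd_tilt_integral {v : ℝ} (hv : 0 < v) (l : ℝ) :
    ∫ x, gd v x * Real.exp (l * x) = Real.exp (l ^ 2 * v / 2) := by
  rw [gd_tilt hv, integral_const_mul, ProbabilityTheory.integral_gaussianPDFReal_eq_one, mul_one]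
  intro h
  rw [Real.toNNReal_eq_zero] at h
  linarith

lemma cell_hasSum {d : ℝ} (hd : 0 < d) {f : ℝ → ℝ} (hf : Integrable f) :
    HasSum (fun j : ℤ => ∫ x in (((j : ℝ) - 1/2) * d)..(((j : ℝ) + 1/2) * d), f x) (∫ x, f x) := by
  have e : ∀ j : ℤ, Ioc (-(d/2) + j • d) (-(d/2) + (j + 1) • d)
      = Ioc (((j : ℝ) - 1/2) * d) (((j : ℝ) + 1/2) * d) := by
    intro j
    congr 1 <;> simp only [zsmul_eq_mul] <;> push_cast <;> ring
  have hU := iUnion_Ioc_add_zsmul hd (-(d/2))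
  have hD := pairwise_disjoint_Ioc_add_zsmul (-(d/2)) d
  simp only [e] at hU hD
  have := hasSum_integral_iUnion (μ := volume) (f := f)
    (fun j : ℤ => (measurableSet_Ioc : MeasurableSet (Ioc (((j : ℝ) - 1/2) * d) (((j : ℝ) + 1/2) * d))))
    hD (by rw [hU]; exact hf.integrableOn)
  rw [hU, setIntegral_univ] at this
  have e2 : (fun j : ℤ => ∫ x in (((j : ℝ) - 1/2) * d)..(((j : ℝ) + 1/2) * d), f x) =
      fun j : ℤ => ∫ x in Ioc (((j : ℝ) - 1/2) * d) (((j : ℝ) + 1/2) * d), f x := by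
    funext j
    rw [intervalIntegral.integral_of_le]
    nlinarith
  rw [e2]
  exact this

lemma gaussMu_eq (v d : ℝ) (j : ℤ) :
    gaussMu v d j = ∫ x in (((j : ℝ) - 1/2) * d)..(((j : ℝ) + 1/2) * d), gd v x := rfl

lemma gaussMu_pos {v d : ℝ} (hv : 0 < v) (hd : 0 < d) (j : ℤ) : 0 < gaussMu v d j := by
  rw [gaussMu_eq]
  apply intervalIntegral.intervalIntegral_pos_of_pos ((gd_cont v).intervalIntegrable _ _) (gd_pos hv)
  nlinarith

lemma gaussMu_neg (v d : ℝ) (j : ℤ) : gaussMu v d (-j) = gaussMu v d j := by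
  rw [gaussMu_eq, gaussMu_eq]
  have h := intervalIntegral.integral_comp_neg (a := ((j : ℝ) - 1/2) * d) (b := ((j : ℝ) + 1/2) * d) (gd v)
  have h2 : (fun x => gd v (-x)) = gd v := by funext x; simp [gd]
  simp only [funext_iff] at h2
  simp only [h2] at h
  rw [h]
  congr 1 <;> push_cast <;> ring

lemma gaussMu_hasSum {v d : ℝ} (hv : 0 < v) (hd : 0 < d) : HasSum (gaussMu v d) 1 := by
  have h := cell_hasSum hd (gd_tilt_int hv 0)
  rw [gd_tilt_integral hv] at h
  simp only [zero_mul, Real.exp_zero, mul_one] at h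
  have e : Real.exp (0 ^ 2 * v / 2) = 1 := by simp
  rw [e] at h
  exact h

lemma term_le {v d : ℝ} (hv : 0 < v) (hd : 0 < d) (l : ℝ) (j : ℤ) :
    gaussMu v d j * Real.exp (l * (j * d)) ≤ Real.exp (|l| * d / 2) *
      ∫ x in (((j : ℝ) - 1/2) * d)..(((j : ℝ) + 1/2) * d), gd v x * Real.exp (l * x) := by
  rw [gaussMu_eq, ← intervalIntegral.integral_mul_const, ← intervalIntegral.integral_const_mul]
  have hc := gd_cont v
  apply intervalIntegral.integral_mono_on (by nlinarith)
  · exact Continuous.intervalIntegrable (by fun_prop) _ _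
  · exact Continuous.intervalIntegrable (by fun_prop) _ _
  · intro x hx
    rw [mul_left_comm (Real.exp _), ← Real.exp_add]
    have hg := (gd_pos hv x).le
    apply mul_le_mul_of_nonneg_left _ hg
    apply Real.exp_le_exp.2
    have h1 : |j * d - x| ≤ d / 2 := by
      rw [abs_le]; constructor <;> nlinarith [hx.1, hx.2]
    have h2 : l * (j * d - x) ≤ |l| * (d / 2) := by
      calc _ ≤ |l * (j * d - x)| := le_abs_self _
        _ = |l| * |j * d - x| := abs_mul _ _
        _ ≤ _ := by gcongr
    linarith

lemma M_summable {v d : ℝ} (hv : 0 < v) (hd : 0 < d) (l : ℝ) :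
    Summable (fun j : ℤ => gaussMu v d j * Real.exp (l * (j * d))) :=
  Summable.of_nonneg_of_le (fun j => (mul_pos (gaussMu_pos hv hd j) (Real.exp_pos _)).le)
    (term_le hv hd l) ((cell_hasSum hd (gd_tilt_int hv l)).summable.mul_left _)

/-- mgf -/
noncomputable def MM (v d l : ℝ) : ℝ := ∑' j : ℤ, gaussMu v d j * Real.exp (l * (j * d))

lemma MM_le {v d : ℝ} (hv : 0 < v) (hd : 0 < d) (l : ℝ) :
    MM v d l ≤ Real.exp (|l| * d / 2 + l ^ 2 * v / 2) := by
  have h := (cell_hasSum hd (gd_tilt_int hv l)).mul_left (Real.exp (|l| * d / 2))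
  rw [gd_tilt_integral hv] at h
  rw [Real.exp_add, ← h.tsum_eq]
  exact (M_summable hv hd l).tsum_le_tsum (term_le hv hd l) h.summable

lemma MM_ge {v d : ℝ} (hv : 0 < v) (hd : 0 < d) (l : ℝ) : 1 ≤ MM v d l := by
  have h1 := (M_summable hv hd l).hasSum
  have h2 : HasSum (fun j : ℤ => gaussMu v d j * Real.exp (-(l * (j * d)))) (MM v d l) := by
    have := (Equiv.neg ℤ).hasSum_iff.2 h1
    have e : (fun j : ℤ => gaussMu v d j * Real.exp (-(l * (j * d)))) =
        (fun j : ℤ => gaussMu v d j * Real.exp (l * (j * d))) ∘ (Equiv.neg ℤ) := by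
      funext j
      simp [gaussMu_neg]
    rw [e]
    exact this
  have h3 := h1.add h2
  have h4 := (gaussMu_hasSum hv hd).mul_right 2
  have := hasSum_le (fun j => ?_) h4 h3
  · change 1 * 2 ≤ MM v d l + MM v d l at this
    linarith
  · have hp := gaussMu_pos hv hd j
    have a := Real.add_one_le_exp (l * (j * d))
    have b := Real.add_one_le_exp (-(l * (j * d)))
    nlinarith

lemma MM_ge_term {v d : ℝ} (hv : 0 < v) (hd : 0 < d) (l : ℝ) (j : ℤ) :
    Real.log (gaussMu v d j) + l * (j * d) ≤ LambdaFn v d l := by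
  have hp := gaussMu_pos hv hd j
  rw [← Real.log_exp (l * (j * d)), ← Real.log_mul hp.ne' (Real.exp_pos _).ne']
  apply Real.log_le_log (by positivity)
  exact (M_summable hv hd l).le_tsum j
    (fun i _ => (mul_pos (gaussMu_pos hv hd i) (Real.exp_pos _)).le)

lemma bdd {v d : ℝ} (hv : 0 < v) (hd : 0 < d) {z : ℝ} (hz : 0 < z) :
    BddAbove (range fun l : ℝ => l * z - LambdaFn v d l) := by
  obtain ⟨n, hn⟩ := exists_nat_gt (z / d)
  rw [div_lt_iff₀ hd] at hn
  refine ⟨max (-Real.log (gaussMu v d 0)) (-Real.log (gaussMu v d n)), ?_⟩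
  rintro _ ⟨l, rfl⟩
  rcases le_total l 0 with h | h
  · apply le_max_of_le_left
    have := MM_ge_term hv hd l 0
    simp at this
    simp only
    nlinarith
  · apply le_max_of_le_right
    have := MM_ge_term hv hd l n
    simp at this
    simp only
    nlinarith

lemma MM_convex {v d : ℝ} (hv : 0 < v) (hd : 0 < d) (y : ℝ) :
    ConvexOn ℝ univ (fun l => MM v d l * Real.exp (-(l * y))) := by
  have hs : ∀ l, HasSum (fun j : ℤ => gaussMu v d j * Real.exp (l * (j * d - y)))
      (MM v d l * Real.exp (-(l * y))) := by
    intro l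
    have e : (fun j : ℤ => gaussMu v d j * Real.exp (l * (j * d - y))) =
        fun j : ℤ => gaussMu v d j * Real.exp (l * (j * d)) * Real.exp (-(l * y)) := by
      funext j
      rw [mul_assoc, ← Real.exp_add]
      ring_nf
    rw [e]
    exact (M_summable hv hd l).hasSum.mul_right (Real.exp (-(l * y)))
  refine ⟨convex_univ, fun a _ b _ s t hs0 ht0 hst => ?_⟩
  refine hasSum_le (fun j => ?_) (hs _) (((hs a).mul_left s).add ((hs b).mul_left t))
  have hp := gaussMu_pos hv hd j
  have := convexOn_exp.2 (mem_univ (a * (j * d - y))) (mem_univ (b * (j * d - y))) hs0 ht0 hst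
  simp only [smul_eq_mul] at this ⊢
  calc _ = gaussMu v d j * Real.exp (s * (a * (j * d - y)) + t * (b * (j * d - y))) := by ring_nf
    _ ≤ gaussMu v d j * _ := mul_le_mul_of_nonneg_left this hp.le
    _ = _ := by ring

lemma key {v d y : ℝ} (hv : 0 < v) (hd : 0 < d) (hy : 0 < y) (hxy : d < y / 2) {l : ℝ}
    (hl : l < y / (4 * v)) :
    l * y - LambdaFn v d l ≤ y / (4 * v) * y - LambdaFn v d (y / (4 * v)) := by
  set l0 := y / (4 * v) with hl0
  have hl0p : 0 < l0 := by positivity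
  have hyv : y = 4 * v * l0 := by rw [hl0]; field_simp
  have h1 : MM v d (2 * l0) * Real.exp (-(2 * l0 * y)) ≤ MM v d l0 * Real.exp (-(l0 * y)) := by
    calc _ ≤ Real.exp (|2 * l0| * d / 2 + (2 * l0) ^ 2 * v / 2) * Real.exp (-(2 * l0 * y)) := by
          gcongr; exact MM_le hv hd _
      _ ≤ 1 * Real.exp (-(l0 * y)) := by
          rw [← Real.exp_add, one_mul, abs_of_pos (by positivity)]
          apply Real.exp_le_exp.2
          have : l0 * d ≤ l0 * (y / 2) := by gcongr
          rw [hyv] at this ⊢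
          nlinarith
      _ ≤ _ := by gcongr; exact MM_ge hv hd _
  have h2 : MM v d l0 * Real.exp (-(l0 * y)) ≤ MM v d l * Real.exp (-(l * y)) := by
    by_contra! hc
    have := (MM_convex hv hd y).lt_right_of_left_lt (mem_univ l) (mem_univ (2 * l0))
      (z := l0) (by rw [openSegment_eq_Ioo (by linarith)]; constructor <;> linarith) hc
    linarith
  have hM := MM_ge hv hd l0
  have hM' := MM_ge hv hd l
  have h3 := Real.log_le_log (by positivity) h2
  rw [Real.log_mul (by positivity) (Real.exp_pos _).ne', Real.log_mul (by positivity) (Real.exp_pos _).ne',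
    Real.log_exp, Real.log_exp] at h3
  change Real.log (MM v d l0) + _ ≤ Real.log (MM v d l) + _ at h3
  change l * y - Real.log (MM v d l) ≤ l0 * y - Real.log (MM v d l0)
  linarith

/-- Let `y > 0` with `Δx < y/2`. Then for every `η ≥ 0`,
`I(y) + (y²/(4Δt))·η ≤ I((1+η)y)`. -/
theorem stmt_5 (Δt Δx : ℝ) (hΔt : 0 < Δt) (hΔx : 0 < Δx) (y : ℝ) (hy : 0 < y)
    (hxy : Δx < y / 2) (η : ℝ) (hη : 0 ≤ η) :
    rateI Δt Δx y + y ^ 2 / (4 * Δt) * η ≤ rateI Δt Δx ((1 + η) * y) := by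
  have hz : 0 < (1 + η) * y := by positivity
  have hB := bdd hΔt hΔx hz
  have main : ∀ l, y / (4 * Δt) ≤ l →
      l * y - LambdaFn Δt Δx l + y ^ 2 / (4 * Δt) * η ≤ rateI Δt Δx ((1 + η) * y) := by
    intro l hl
    have h1 : l * ((1 + η) * y) - LambdaFn Δt Δx l ≤ rateI Δt Δx ((1 + η) * y) := le_ciSup hB l
    have h2 : y / (4 * Δt) * (y * η) ≤ l * (y * η) := by gcongr
    have h3 : y ^ 2 / (4 * Δt) * η = y / (4 * Δt) * (y * η) := by ring
    rw [h3]
    linarith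
  rw [← le_sub_iff_add_le]
  apply ciSup_le
  intro l
  rw [le_sub_iff_add_le]
  rcases le_or_gt (y / (4 * Δt)) l with h | h
  · exact main l h
  · have := key hΔt hΔx hy hxy h
    have := main _ le_rfl
    linarith
end

section
/- Let y̲ > 0 with Δx < y̲/2. Then for all y₁, y₂ ≥ y̲, (y̲/(4Δt))·|y₁ − y₂| ≤ |I(y₁) − I(y₂)|. -/
open MeasureTheory Real Set

/-- The rounding map. -/
noncomputable def rndX (Δx : ℝ) (z : ℝ) : ℝ := (⌈z / Δx - 1 / 2⌉ : ℤ) * Δx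

noncomputable def gP (Δt : ℝ) : Measure ℝ := ProbabilityTheory.gaussianReal 0 (Real.toNNReal Δt)

noncomputable def mG (Δt Δx l : ℝ) : ℝ := ∫ z, Real.exp (l * rndX Δx z) ∂(gP Δt)

instance (Δt : ℝ) : IsProbabilityMeasure (gP Δt) := by unfold gP; infer_instance

lemma rndX_dist (Δx : ℝ) (h : 0 < Δx) (z : ℝ) : |rndX Δx z - z| ≤ Δx / 2 := by
  have h1 := Int.le_ceil (z / Δx - 1 / 2)
  have h2 := Int.ceil_lt_add_one (z / Δx - 1 / 2)
  have hz : z = (z / Δx) * Δx := by field_simp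
  unfold rndX
  set c : ℝ := ((⌈z / Δx - 1 / 2⌉ : ℤ) : ℝ)
  set w := z / Δx
  rw [hz, abs_le]
  constructor <;> nlinarith

lemma rndX_mul_le (Δx : ℝ) (h : 0 < Δx) (l z : ℝ) :
    |l * rndX Δx z - l * z| ≤ |l| * Δx / 2 := by
  rw [← mul_sub, abs_mul]
  have := mul_le_mul_of_nonneg_left (rndX_dist Δx h z) (abs_nonneg l)
  linarith

lemma rndX_meas (Δx : ℝ) : Measurable (rndX Δx) := by
  unfold rndX
  have h1 : Measurable fun z : ℝ => ⌈z / Δx - 1 / 2⌉ := by fun_prop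
  have h2 : Measurable (fun n : ℤ => (n : ℝ)) := measurable_from_top
  exact (h2.comp h1).mul_const _

lemma int_exp (Δt l : ℝ) : Integrable (fun z => Real.exp (l * z)) (gP Δt) :=
  ProbabilityTheory.integrable_exp_mul_gaussianReal l

lemma gP_integral_exp (Δt : ℝ) (h : 0 < Δt) (l : ℝ) :
    ∫ z, Real.exp (l * z) ∂(gP Δt) = Real.exp (Δt * l ^ 2 / 2) := by
  have := congrFun (ProbabilityTheory.mgf_fun_id_gaussianReal (μ := 0) (v := Real.toNNReal Δt)) l
  simpa [ProbabilityTheory.mgf, gP, h.le] using this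

lemma int_rnd (Δt Δx : ℝ) (h : 0 < Δx) (l : ℝ) :
    Integrable (fun z => Real.exp (l * rndX Δx z)) (gP Δt) := by
  refine Integrable.mono' ((int_exp Δt l).const_mul (Real.exp (|l| * Δx / 2))) ?_ ?_
  · exact (((rndX_meas Δx).const_mul l).exp).aestronglyMeasurable
  · refine Filter.Eventually.of_forall fun z => ?_
    rw [Real.norm_eq_abs, Real.abs_exp, ← Real.exp_add]
    apply Real.exp_le_exp.2
    have := (abs_le.1 (rndX_mul_le Δx h l z)).2
    linarith

lemma mG_le (Δt Δx : ℝ) (ht : 0 < Δt) (h : 0 < Δx) (l : ℝ) :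
    mG Δt Δx l ≤ Real.exp (|l| * Δx / 2 + Δt * l ^ 2 / 2) := by
  rw [Real.exp_add, ← gP_integral_exp Δt ht, ← integral_const_mul]
  refine integral_mono (int_rnd Δt Δx h l) ((int_exp Δt l).const_mul _) fun z => ?_
  simp only [← Real.exp_add]
  apply Real.exp_le_exp.2
  have := (abs_le.1 (rndX_mul_le Δx h l z)).2
  linarith

lemma le_mG (Δt Δx : ℝ) (ht : 0 < Δt) (h : 0 < Δx) (l : ℝ) :
    Real.exp (-(|l| * Δx / 2) + Δt * l ^ 2 / 2) ≤ mG Δt Δx l := by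
  rw [Real.exp_add, ← gP_integral_exp Δt ht, ← integral_const_mul]
  refine integral_mono ((int_exp Δt l).const_mul _) (int_rnd Δt Δx h l) fun z => ?_
  simp only [← Real.exp_add]
  apply Real.exp_le_exp.2
  have := (abs_le.1 (rndX_mul_le Δx h l z)).1
  linarith

lemma mG_pos (Δt Δx : ℝ) (ht : 0 < Δt) (h : 0 < Δx) (l : ℝ) : 0 < mG Δt Δx l :=
  (Real.exp_pos _).trans_le (le_mG Δt Δx ht h l)

lemma convex_mG (Δt Δx : ℝ) (ht : 0 < Δt) (h : 0 < Δx) :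
    ConvexOn ℝ Set.univ (fun l => Real.log (mG Δt Δx l)) := by
  refine ⟨convex_univ, fun a _ b _ p q hp hq hpq => ?_⟩
  simp only [smul_eq_mul]
  set A := Real.log (mG Δt Δx a) with hA
  set B := Real.log (mG Δt Δx b) with hB
  have eA : mG Δt Δx a = Real.exp A := (Real.exp_log (mG_pos Δt Δx ht h a)).symm
  have eB : mG Δt Δx b = Real.exp B := (Real.exp_log (mG_pos Δt Δx ht h b)).symm
  rw [Real.log_le_iff_le_exp (mG_pos Δt Δx ht h _)]
  have key : mG Δt Δx (p * a + q * b) ≤ ∫ z, Real.exp (p * A + q * B) *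
      (p * (Real.exp (-A) * Real.exp (a * rndX Δx z))
        + q * (Real.exp (-B) * Real.exp (b * rndX Δx z))) ∂(gP Δt) := by
    refine integral_mono (int_rnd Δt Δx h _) ?_ fun z => ?_
    · exact ((((int_rnd Δt Δx h a).const_mul _).const_mul _).add
        (((int_rnd Δt Δx h b).const_mul _).const_mul _)).const_mul _
    · have := convexOn_exp.2 (Set.mem_univ (-A + a * rndX Δx z))
        (Set.mem_univ (-B + b * rndX Δx z)) hp hq hpq
      simp only [smul_eq_mul] at this
      simp only [← Real.exp_add]
      calc _ = Real.exp (p * A + q * B) * Real.exp (p * (-A + a * rndX Δx z) +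
              q * (-B + b * rndX Δx z)) := by rw [← Real.exp_add]; congr 1; ring
        _ ≤ _ := mul_le_mul_of_nonneg_left this (Real.exp_pos _).le
  refine key.trans (le_of_eq ?_)
  rw [integral_const_mul, integral_add, integral_const_mul, integral_const_mul,
    integral_const_mul, integral_const_mul]
  · change Real.exp (p * A + q * B) * (p * (Real.exp (-A) * mG Δt Δx a)
      + q * (Real.exp (-B) * mG Δt Δx b)) = _
    rw [eA, eB, ← Real.exp_add, ← Real.exp_add]
    simp [hpq]
  · exact (((int_rnd Δt Δx h a).const_mul _).const_mul _)
  · exact (((int_rnd Δt Δx h b).const_mul _).const_mul _)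

lemma ceil_set (Δx : ℝ) (h : 0 < Δx) (j : ℤ) :
    (fun z : ℝ => ⌈z / Δx - 1 / 2⌉) ⁻¹' {j} =
      Set.Ioc (((j : ℝ) - 1/2) * Δx) (((j : ℝ) + 1/2) * Δx) := by
  ext z
  simp only [Set.mem_preimage, Set.mem_singleton_iff, Set.mem_Ioc, Int.ceil_eq_iff]
  rw [← lt_div_iff₀ h, ← div_le_iff₀ h]
  constructor <;> rintro ⟨h1, h2⟩ <;> constructor <;> linarith

lemma gaussMu_eq_s6 (Δt Δx : ℝ) (ht : 0 < Δt) (h : 0 < Δx) (j : ℤ) :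
    gaussMu Δt Δx j = (gP Δt).real (Set.Ioc (((j : ℝ) - 1/2) * Δx) (((j : ℝ) + 1/2) * Δx)) := by
  have hv : Real.toNNReal Δt ≠ 0 := by simpa using ht
  unfold gaussMu gP Measure.real
  rw [ProbabilityTheory.gaussianReal_apply_eq_integral _ hv, ENNReal.toReal_ofReal,
    intervalIntegral.integral_of_le (by nlinarith)]
  · simp [ProbabilityTheory.gaussianPDFReal, ht.le]
  · exact integral_nonneg fun x => ProbabilityTheory.gaussianPDFReal_nonneg _ _ _

lemma tsum_eq_mG (Δt Δx : ℝ) (ht : 0 < Δt) (h : 0 < Δx) (l : ℝ) :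
    ∑' j : ℤ, gaussMu Δt Δx j * Real.exp (l * (j * Δx)) = mG Δt Δx l := by
  set s : ℤ → Set ℝ := fun j => (fun z : ℝ => ⌈z / Δx - 1 / 2⌉) ⁻¹' {j} with hs
  have hm : ∀ j, MeasurableSet (s j) := fun j => by
    simp only [hs, ceil_set Δx h j]; exact measurableSet_Ioc
  have hd : Pairwise (Function.onFun Disjoint s) := fun i j hij => by
    refine Set.disjoint_left.2 fun z hz hz' => hij ?_
    simp only [hs, Set.mem_preimage, Set.mem_singleton_iff] at hz hz'
    exact hz.symm.trans hz'
  have hU : ⋃ j, s j = Set.univ := by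
    ext z; simp [hs]
  have := integral_iUnion hm hd (int_rnd Δt Δx h l).integrableOn
  rw [hU, setIntegral_univ] at this
  unfold mG
  rw [this]
  congr 1
  ext j
  have : ∫ z in s j, Real.exp (l * rndX Δx z) ∂(gP Δt)
      = ∫ z in s j, Real.exp (l * (j * Δx)) ∂(gP Δt) := by
    refine setIntegral_congr_fun (hm j) fun z hz => ?_
    simp only [hs, Set.mem_preimage, Set.mem_singleton_iff] at hz
    simp only [rndX, hz]
  rw [this, setIntegral_const, smul_eq_mul, gaussMu_eq_s6 Δt Δx ht h, ← ceil_set Δx h j]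

lemma Lam_eq (Δt Δx : ℝ) (ht : 0 < Δt) (h : 0 < Δx) :
    LambdaFn Δt Δx = fun l => Real.log (mG Δt Δx l) := by
  ext l; rw [LambdaFn, tsum_eq_mG Δt Δx ht h]

lemma Lam_le (Δt Δx : ℝ) (ht : 0 < Δt) (h : 0 < Δx) (l : ℝ) :
    LambdaFn Δt Δx l ≤ |l| * Δx / 2 + Δt * l ^ 2 / 2 := by
  rw [Lam_eq Δt Δx ht h]
  exact (Real.log_le_iff_le_exp (mG_pos Δt Δx ht h l)).2 (mG_le Δt Δx ht h l)

lemma le_Lam (Δt Δx : ℝ) (ht : 0 < Δt) (h : 0 < Δx) (l : ℝ) :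
    -(|l| * Δx / 2) + Δt * l ^ 2 / 2 ≤ LambdaFn Δt Δx l := by
  rw [Lam_eq Δt Δx ht h]
  exact (Real.le_log_iff_exp_le (mG_pos Δt Δx ht h l)).2 (le_mG Δt Δx ht h l)

lemma bdd_rate (Δt Δx : ℝ) (ht : 0 < Δt) (h : 0 < Δx) (y : ℝ) :
    BddAbove (Set.range fun l : ℝ => l * y - LambdaFn Δt Δx l) := by
  refine ⟨(|y| + Δx / 2) ^ 2 / (2 * Δt), ?_⟩
  rintro _ ⟨l, rfl⟩
  have h1 := le_Lam Δt Δx ht h l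
  have h2 : l * y ≤ |l| * |y| := by rw [← abs_mul]; exact le_abs_self _
  rw [← sq_abs l] at h1
  rw [le_div_iff₀ (by positivity)]
  simp only
  have h3 : l * y - LambdaFn Δt Δx l ≤ |l| * (|y| + Δx / 2) - Δt * |l| ^ 2 / 2 := by linarith
  have := mul_le_mul_of_nonneg_right h3 (by positivity : 0 ≤ 2 * Δt)
  nlinarith [sq_nonneg (|y| + Δx / 2 - Δt * |l|)]

lemma rate_mono (Δt Δx : ℝ) (hΔt : 0 < Δt) (hΔx : 0 < Δx) (ylo : ℝ) (hylo : 0 < ylo)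
    (hxy : Δx < ylo / 2) (y₁ y₂ : ℝ) (hy₁ : ylo ≤ y₁) (hy : y₁ ≤ y₂) :
    ylo / (4 * Δt) * (y₂ - y₁) ≤ rateI Δt Δx y₂ - rateI Δt Δx y₁ := by
  set k := ylo / (4 * Δt) with hk
  have hkpos : 0 < k := by positivity
  have hkt : Δt * k = ylo / 4 := by rw [hk]; field_simp
  have bd := bdd_rate Δt Δx hΔt hΔx y₂
  suffices rateI Δt Δx y₁ ≤ rateI Δt Δx y₂ - k * (y₂ - y₁) by linarith
  have big : ∀ l, k ≤ l →
      l * y₁ - LambdaFn Δt Δx l ≤ rateI Δt Δx y₂ - k * (y₂ - y₁) := fun l hl => by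
    have := le_ciSup bd l
    change _ ≤ rateI Δt Δx y₂ at this
    nlinarith [mul_nonneg (sub_nonneg.2 hl) (sub_nonneg.2 hy)]
  refine ciSup_le fun l => ?_
  rcases le_or_gt k l with hl | hl
  · exact big l hl
  refine le_trans ?_ (big k le_rfl)
  have hc := (convex_mG Δt Δx hΔt hΔx)
  rw [← Lam_eq Δt Δx hΔt hΔx] at hc
  have sl := hc.slope_mono_adjacent (Set.mem_univ l) (Set.mem_univ (3 * k)) hl
    (by linarith : k < 3 * k)
  have u := Lam_le Δt Δx hΔt hΔx (3 * k)
  have v := le_Lam Δt Δx hΔt hΔx k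
  rw [abs_of_pos hkpos] at v
  rw [abs_of_pos (by positivity)] at u
  have e : LambdaFn Δt Δx (3 * k) - LambdaFn Δt Δx k ≤ ylo * (3 * k - k) := by
    have e1 : Δt * (3 * k) ^ 2 / 2 - Δt * k ^ 2 / 2 = ylo * k := by
      linear_combination (4 * k) * hkt
    nlinarith [mul_pos hkpos (sub_pos.2 hxy)]
  have e2 := sl.trans ((div_le_iff₀ (by linarith)).2 e)
  rw [div_le_iff₀ (by linarith)] at e2
  nlinarith [mul_nonneg (sub_nonneg.2 hy₁) (sub_pos.2 hl).le]

/-- Let `ylo > 0` with `Δx < ylo/2`. Then for all `y₁, y₂ ≥ ylo`,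
`(ylo/(4Δt))·|y₁ − y₂| ≤ |I(y₁) − I(y₂)|`. -/
theorem stmt_6 (Δt Δx : ℝ) (hΔt : 0 < Δt) (hΔx : 0 < Δx) (ylo : ℝ) (hylo : 0 < ylo)
    (hxy : Δx < ylo / 2) (y₁ y₂ : ℝ) (hy₁ : ylo ≤ y₁) (hy₂ : ylo ≤ y₂) :
    ylo / (4 * Δt) * |y₁ - y₂| ≤ |rateI Δt Δx y₁ - rateI Δt Δx y₂| := by
  rcases le_total y₁ y₂ with h | h
  · have := rate_mono Δt Δx hΔt hΔx ylo hylo hxy y₁ y₂ hy₁ h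
    rw [abs_sub_comm y₁, abs_sub_comm (rateI _ _ _), abs_of_nonneg (sub_nonneg.2 h)]
    exact this.trans (le_abs_self _)
  · have := rate_mono Δt Δx hΔt hΔx ylo hylo hxy y₂ y₁ hy₂ h
    rw [abs_of_nonneg (sub_nonneg.2 h)]
    exact this.trans (le_abs_self _)
end

section
/- Let 0 < r̲ ≤ r̄ ≤ R, let γ = log 2, and assume Δt < 1/R and Δx < (1/16)·√(2γr̲)·Δt. If c̄ > 0 is the unique positive solution of I(c̄) = log(1 + r̄Δt), then |c̄ − √(2Δt·log(1 + r̄Δt))| ≤ a·Δx, where a = 16·γ^{−1/2}·(r̄/r̲)^{1/2}. -/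
open MeasureTheory Real Set

lemma aux_int (Δt Δx : ℝ) (h : 0 < Δt) (hx : 0 < Δx) (l : ℝ) :
    HasSum (fun j : ℤ => ∫ x in (((j : ℝ) - 1/2) * Δx)..(((j : ℝ) + 1/2) * Δx),
      (Real.sqrt (2 * Real.pi * Δt))⁻¹ * Real.exp (-x ^ 2 / (2 * Δt)) * Real.exp (l * x))
      (Real.exp (l ^ 2 * Δt / 2)) := by
  set f : ℝ → ℝ := fun x =>
    (Real.sqrt (2 * Real.pi * Δt))⁻¹ * Real.exp (-x ^ 2 / (2 * Δt)) * Real.exp (l * x) with hf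
  have hv : Δt.toNNReal ≠ 0 := (Real.toNNReal_pos.2 h).ne'
  have hfe : f = fun x => Real.exp (l ^ 2 * Δt / 2) *
      ProbabilityTheory.gaussianPDFReal (l * Δt) Δt.toNNReal x := by
    funext x
    have hco : (Δt.toNNReal : ℝ) = Δt := Real.coe_toNNReal _ h.le
    simp only [hf, ProbabilityTheory.gaussianPDFReal]
    rw [hco]
    rw [mul_assoc, ← Real.exp_add, mul_left_comm, ← Real.exp_add]
    congr 2
    field_simp
    ring
  have hfi : Integrable f := by
    rw [hfe]; exact (ProbabilityTheory.integrable_gaussianPDFReal _ _).const_mul _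
  have hint : ∫ x, f x = Real.exp (l ^ 2 * Δt / 2) := by
    rw [hfe, integral_const_mul, ProbabilityTheory.integral_gaussianPDFReal_eq_one _ hv, mul_one]
  have hg : Integrable (fun u => Δx * f (u * Δx)) :=
    (hfi.comp_mul_right' hx.ne').const_mul _
  have key := hg.hasSum_intervalIntegral (-(1/2))
  have hI : ∫ u, Δx * f (u * Δx) = Real.exp (l ^ 2 * Δt / 2) := by
    rw [integral_const_mul, Measure.integral_comp_mul_right, hint, abs_of_pos (inv_pos.2 hx),
      smul_eq_mul, mul_inv_cancel_left₀ hx.ne']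
  rw [hI] at key
  have hfun : (fun n : ℤ => ∫ x in (-(1/2) + (n:ℝ))..(-(1/2) + (n:ℝ) + 1), Δx * f (x * Δx))
      = fun j : ℤ => ∫ x in (((j : ℝ) - 1/2) * Δx)..(((j : ℝ) + 1/2) * Δx), f x := by
    funext j
    rw [intervalIntegral.integral_const_mul, intervalIntegral.mul_integral_comp_mul_right]
    congr 1 <;> ring
  rw [hfun] at key
  exact key

lemma aux_bd (Δt Δx : ℝ) (h : 0 < Δt) (hx : 0 < Δx) (l : ℝ) :
    |LambdaFn Δt Δx l - l ^ 2 * Δt / 2| ≤ |l| * Δx / 2 := by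
  set F : ℤ → ℝ := fun j => ∫ x in (((j : ℝ) - 1/2) * Δx)..(((j : ℝ) + 1/2) * Δx),
      (Real.sqrt (2 * Real.pi * Δt))⁻¹ * Real.exp (-x ^ 2 / (2 * Δt)) * Real.exp (l * x) with hF
  have hs : HasSum F _ := aux_int Δt Δx h hx l
  have hle : ∀ j : ℤ, ((j : ℝ) - 1/2) * Δx ≤ ((j : ℝ) + 1/2) * Δx := fun j => by nlinarith
  have hdist : ∀ j : ℤ, ∀ x ∈ Icc (((j : ℝ) - 1/2) * Δx) (((j : ℝ) + 1/2) * Δx),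
      |l * (j * Δx) - l * x| ≤ |l| * Δx / 2 := by
    intro j x hxx
    rw [← mul_sub, abs_mul, mul_div_assoc]
    gcongr
    rw [abs_le]; constructor <;> nlinarith [hxx.1, hxx.2]
  have up : ∀ j, gaussMu Δt Δx j * Real.exp (l * (j * Δx)) ≤ Real.exp (|l| * Δx / 2) * F j := by
    intro j
    simp only [hF, gaussMu]
    rw [← intervalIntegral.integral_mul_const, ← intervalIntegral.integral_const_mul]
    apply intervalIntegral.integral_mono_on (hle j)
    · exact Continuous.intervalIntegrable (by fun_prop) _ _
    · exact Continuous.intervalIntegrable (by fun_prop) _ _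
    · intro x hxx
      rw [mul_left_comm (Real.exp _) _ (Real.exp _), ← Real.exp_add]
      gcongr
      linarith [(abs_le.1 (hdist j x hxx)).2]
  have lo : ∀ j, Real.exp (-(|l| * Δx / 2)) * F j ≤ gaussMu Δt Δx j * Real.exp (l * (j * Δx)) := by
    intro j
    simp only [hF, gaussMu]
    rw [← intervalIntegral.integral_mul_const, ← intervalIntegral.integral_const_mul]
    apply intervalIntegral.integral_mono_on (hle j)
    · exact Continuous.intervalIntegrable (by fun_prop) _ _
    · exact Continuous.intervalIntegrable (by fun_prop) _ _
    · intro x hxx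
      rw [mul_left_comm (Real.exp _) _ (Real.exp _), ← Real.exp_add]
      gcongr
      linarith [(abs_le.1 (hdist j x hxx)).1]
  have hF0 : ∀ j, 0 ≤ F j := fun j =>
    intervalIntegral.integral_nonneg (hle j) (fun x _ => by positivity)
  have hsum : Summable (fun j : ℤ => gaussMu Δt Δx j * Real.exp (l * (j * Δx))) :=
    Summable.of_nonneg_of_le (fun j => le_trans (mul_nonneg (Real.exp_pos _).le (hF0 j)) (lo j)) up
      (hs.summable.mul_left _)
  have h1 := hasSum_le up hsum.hasSum (hs.mul_left _)
  have h2 := hasSum_le lo (hs.mul_left _) hsum.hasSum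
  rw [← Real.exp_add] at h1 h2
  have hpos := lt_of_lt_of_le (Real.exp_pos _) h2
  have h3 := (Real.log_le_iff_le_exp hpos).2 h1
  have h4 := (Real.le_log_iff_exp_le hpos).2 h2
  rw [abs_le]
  unfold LambdaFn
  constructor <;> linarith

/-- Under the same assumptions as the previous lemma, if `c̄ > 0` solves
`I(c̄) = log(1 + rbar·Δt)`, then `|c̄ − √(2Δt·log(1 + rbar·Δt))| ≤ a·Δx`,
with `a = 16·(log 2)^{-1/2}·(rbar/rlo)^{1/2}`. -/
theorem stmt_8 (Δt Δx : ℝ) (hΔt0 : 0 < Δt) (hΔx0 : 0 < Δx)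
    (rlo rbar R : ℝ) (hrlo : 0 < rlo) (hlole : rlo ≤ rbar) (hleR : rbar ≤ R)
    (hΔt : Δt < 1 / R)
    (hΔx : Δx < 1 / 16 * Real.sqrt (2 * Real.log 2 * rlo) * Δt)
    (c : ℝ) (hc : 0 < c) (hceq : rateI Δt Δx c = Real.log (1 + rbar * Δt)) :
    |c - Real.sqrt (2 * Δt * Real.log (1 + rbar * Δt))| ≤
      16 * (Real.sqrt (Real.log 2))⁻¹ * Real.sqrt (rbar / rlo) * Δx := by
  have hrb : 0 < rbar := by linarith
  have hL : 0 < Real.log (1 + rbar * Δt) := Real.log_pos (by nlinarith [mul_pos hrb hΔt0])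
  set L := Real.log (1 + rbar * Δt) with hLdef
  set s := Real.sqrt (2 * Δt * L) with hs
  have hs0 : 0 ≤ s := Real.sqrt_nonneg _
  have hs2 : s ^ 2 = 2 * Δt * L := Real.sq_sqrt (by positivity)
  have hub : ∀ l : ℝ, l * c - LambdaFn Δt Δx l ≤ (c + Δx / 2) ^ 2 / (2 * Δt) := by
    intro l
    have h1 := (abs_le.1 (aux_bd Δt Δx hΔt0 hΔx0 l)).1
    have h2 : l * c ≤ |l| * c := by gcongr; exact le_abs_self l
    have h3 : |l| * (c + Δx / 2) - l ^ 2 * Δt / 2 ≤ (c + Δx / 2) ^ 2 / (2 * Δt) := by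
      rw [le_div_iff₀ (by positivity), ← sq_abs l]
      nlinarith [sq_nonneg (|l| * Δt - (c + Δx / 2))]
    linarith
  have hI1 : L ≤ (c + Δx / 2) ^ 2 / (2 * Δt) := by
    rw [← hceq]; exact ciSup_le hub
  have hI2 : ∀ l : ℝ, l * c - LambdaFn Δt Δx l ≤ L := by
    intro l
    rw [← hceq]
    exact le_ciSup (f := fun l : ℝ => l * c - LambdaFn Δt Δx l)
      ⟨_, by rintro _ ⟨l, rfl⟩; exact hub l⟩ l
  have hA : s ≤ c + Δx / 2 := by
    rw [le_div_iff₀ (by positivity)] at hI1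
    nlinarith
  have hB : c - Δx / 2 ≤ s := by
    by_contra! hcon
    have hy : 0 < c - Δx / 2 := by linarith
    have h1 := hI2 ((c - Δx / 2) / Δt)
    have h2 := (abs_le.1 (aux_bd Δt Δx hΔt0 hΔx0 ((c - Δx / 2) / Δt))).2
    rw [abs_of_pos (by positivity)] at h2
    have h3 : (c - Δx / 2) / Δt * c - (c - Δx / 2) / Δt * Δx / 2
        - ((c - Δx / 2) / Δt) ^ 2 * Δt / 2 = (c - Δx / 2) ^ 2 / (2 * Δt) := by
      field_simp
      ring
    have h4 : (c - Δx / 2) ^ 2 / (2 * Δt) ≤ L := by linarith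
    rw [div_le_iff₀ (by positivity)] at h4
    nlinarith
  have hg1 : 1 ≤ (Real.sqrt (Real.log 2))⁻¹ := by
    apply (one_le_inv₀ (Real.sqrt_pos.2 (Real.log_pos one_lt_two))).2
    rw [Real.sqrt_le_one]
    linarith [Real.log_two_lt_d9]
  have hg2 : 1 ≤ Real.sqrt (rbar / rlo) := by
    rw [Real.one_le_sqrt, one_le_div hrlo]; exact hlole
  have hg3 : 1 ≤ (Real.sqrt (Real.log 2))⁻¹ * Real.sqrt (rbar / rlo) :=
    one_le_mul_of_one_le_of_one_le hg1 hg2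
  have hg4 : Δx ≤ (Real.sqrt (Real.log 2))⁻¹ * Real.sqrt (rbar / rlo) * Δx :=
    le_mul_of_one_le_left hΔx0.le hg3
  rw [abs_le]
  constructor <;> linarith
end
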